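/- Let (ρ_1,η_1) ∈ ℋ(V_1) and (ρ_2,η_2) ∈ ℋ(V_2). The set 𝓔_0(V_1(ρ_1,η_1), V_2(ρ_2,η_2)) = { η̃_ψ : ψ ∈ Hom_𝔞(V_1,V_2) }, where η̃_ψ(x) = η_2(x)∘ψ − ψ∘η_1(x), is a linear subspace of Hom_𝔞(𝔞, Hom(V_1,V_2)), and the linear map ψ ↦ η̃_ψ induces an isomorphism of vector spaces 𝓔_0(V_1(ρ_1,η_1), V_2(ρ_2,η_2)) ≅ Hom_𝔞(V_1,V_2) / Hom_{𝔞[t]}(V_1(ρ_1,η_1), V_2(ρ_2,η_2)). -/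

import Mathlib

open TensorAlgebra TensorProduct Polynomial

noncomputable section

/-- The graded pieces `F^r(a)` of the free Lie algebra on the vector space `a`,
realized inside the tensor algebra `T(a)`:  `F¹(a) = ι(a)` and `F^{r+1}(a)` is spanned by
the commutators `ι(x) * y - y * ι(x)` with `x ∈ a`, `y ∈ F^r(a)`. -/
def Fr (a : Type*) [LieRing a] [LieAlgebra ℂ a] : ℕ → Submodule ℂ (TensorAlgebra ℂ a)
  | 0 => ⊥
  | 1 => LinearMap.range (TensorAlgebra.ι ℂ (M := a))
  | (r + 2) => Submodule.span ℂ
      {u | ∃ (x : a) (y : TensorAlgebra ℂ a), y ∈ Fr a (r + 1) ∧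
        u = TensorAlgebra.ι ℂ x * y - y * TensorAlgebra.ι ℂ x}

/-- The free Lie algebra `F(a) = ⊕_{r>0} F^r(a)` on the vector space `a`,
as a subspace of the tensor algebra. -/
def FLie (a : Type*) [LieRing a] [LieAlgebra ℂ a] : Submodule ℂ (TensorAlgebra ℂ a) :=
  ⨆ r, Fr a r

/-- `IsTau a τ` says that the linear map `τ` is (a linear extension to `T(a)` of) the canonical
Lie algebra homomorphism `τ : F(a) → a`: it is the identity on `F¹(a) = a` and takes the
commutator bracket of `T(a)` (restricted to `F(a)`) to the bracket of `a`. -/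
def IsTau (a : Type*) [LieRing a] [LieAlgebra ℂ a] (τ : TensorAlgebra ℂ a →ₗ[ℂ] a) : Prop :=
  (∀ x : a, τ (TensorAlgebra.ι ℂ x) = x) ∧
  ∀ r s : ℕ, ∀ u ∈ Fr a r, ∀ v ∈ Fr a s, τ (u * v - v * u) = ⁅τ u, τ v⁆

/-- The current algebra `a[t] = a ⊗ ℂ[t]`, with bracket `⁅x ⊗ f, y ⊗ g⁆ = ⁅x, y⁆ ⊗ fg`. -/
abbrev Cur (a : Type*) [LieRing a] [LieAlgebra ℂ a] : Type _ := Polynomial ℂ ⊗[ℂ] a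

/-- `IsTauT a τ τt` says that the linear map `τt` is (a linear extension to `T(a)` of) the map
`τ[t] : F(a) → a[t]` given by `τ[t](𝐱) = τ(𝐱) ⊗ t^r` for `𝐱 ∈ F^r(a)`. -/
def IsTauT (a : Type*) [LieRing a] [LieAlgebra ℂ a] (τ : TensorAlgebra ℂ a →ₗ[ℂ] a)
    (τt : TensorAlgebra ℂ a →ₗ[ℂ] Cur a) : Prop :=
  ∀ r : ℕ, ∀ u ∈ Fr a r, τt u = ((X : ℂ[X]) ^ r) ⊗ₜ[ℂ] (τ u)

end

noncomputable section

/-- `MemH a V τ ρ η`, i.e. `(ρ, η) ∈ ℋ(V)`:  `ρ` is a Lie algebra homomorphism (C1), `η` is a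
homomorphism of `a`-modules for the `a`-module structure on `End V` induced by `ρ` (C2), and
`ker τ_r ⊆ ker η^{⊙r}` for all `r > 0` (C3), where `η^{⊙r}` is the restriction to
`F^r(a) ⊆ T^r(a)` of the algebra homomorphism `η_T : T(a) → End V` extending `η`. -/
def MemH (a : Type*) [LieRing a] [LieAlgebra ℂ a] {V : Type*} [AddCommGroup V] [Module ℂ V]
    (τ : TensorAlgebra ℂ a →ₗ[ℂ] a) (ρ η : a →ₗ[ℂ] Module.End ℂ V) : Prop :=
  (∀ x y : a, ρ ⁅x, y⁆ = ⁅ρ x, ρ y⁆) ∧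
  (∀ x y : a, η ⁅x, y⁆ = ⁅ρ x, η y⁆) ∧
  (∀ r : ℕ, ∀ u ∈ Fr a r, τ u = 0 → TensorAlgebra.lift ℂ η u = 0)

/-- `IsCurHom a ρ₁ η₁ ρ₂ η₂ φ` says that the linear map `φ : V₁ → V₂` is a homomorphism of
`a[t]`-modules from `V₁(ρ₁, η₁)` to `V₂(ρ₂, η₂)`: it intertwines the actions of `x ⊗ 1`
(given by `ρᵢ`) and of `x ⊗ t^r` (given by `ηᵢ^{⊙r}(𝐱)` for `𝐱 ∈ F^r(a)` with `τ_r(𝐱) = x`). -/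
def IsCurHom (a : Type*) [LieRing a] [LieAlgebra ℂ a]
    {V1 V2 : Type*} [AddCommGroup V1] [Module ℂ V1] [AddCommGroup V2] [Module ℂ V2]
    (ρ1 η1 : a →ₗ[ℂ] Module.End ℂ V1) (ρ2 η2 : a →ₗ[ℂ] Module.End ℂ V2)
    (φ : V1 →ₗ[ℂ] V2) : Prop :=
  (∀ x : a, φ ∘ₗ ρ1 x = ρ2 x ∘ₗ φ) ∧
  ∀ r : ℕ, ∀ u ∈ Fr a r,
    φ ∘ₗ (TensorAlgebra.lift ℂ η1 u : Module.End ℂ V1)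
      = (TensorAlgebra.lift ℂ η2 u : Module.End ℂ V2) ∘ₗ φ

end

noncomputable section

variable (a : Type*) [LieRing a] [LieAlgebra ℂ a]
variable (V1 V2 : Type*) [AddCommGroup V1] [Module ℂ V1] [AddCommGroup V2] [Module ℂ V2]

/-- The space `Hom_a(V₁, V₂)` of `a`-module homomorphisms, as a subspace of `Hom(V₁,V₂)`. -/
def homA (ρ1 : a →ₗ[ℂ] Module.End ℂ V1) (ρ2 : a →ₗ[ℂ] Module.End ℂ V2) :
    Submodule ℂ (V1 →ₗ[ℂ] V2) where
  carrier := {ψ | ∀ x : a, ψ ∘ₗ ρ1 x = ρ2 x ∘ₗ ψ}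
  add_mem' := by
    intro f g hf hg x
    ext v
    simp only [LinearMap.add_comp, LinearMap.comp_add, hf x, hg x]
  zero_mem' := by
    intro x
    ext v
    simp
  smul_mem' := by
    intro c f hf x
    ext v
    simp only [LinearMap.smul_comp, LinearMap.comp_smul, hf x]

/-- The space `Hom_{a[t]}(V₁(ρ₁,η₁), V₂(ρ₂,η₂))` of `a[t]`-module homomorphisms. -/
def homAt (ρ1 η1 : a →ₗ[ℂ] Module.End ℂ V1) (ρ2 η2 : a →ₗ[ℂ] Module.End ℂ V2) :
    Submodule ℂ (V1 →ₗ[ℂ] V2) where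
  carrier := {ψ | IsCurHom a ρ1 η1 ρ2 η2 ψ}
  add_mem' := by
    intro f g hf hg
    refine ⟨fun x => ?_, fun r u hu => ?_⟩
    · ext v; simp only [LinearMap.add_comp, LinearMap.comp_add, hf.1 x, hg.1 x]
    · ext v; simp only [LinearMap.add_comp, LinearMap.comp_add, hf.2 r u hu, hg.2 r u hu]
  zero_mem' := by
    refine ⟨fun x => ?_, fun r u hu => ?_⟩ <;> (ext v; simp)
  smul_mem' := by
    intro c f hf
    refine ⟨fun x => ?_, fun r u hu => ?_⟩
    · ext v; simp only [LinearMap.smul_comp, LinearMap.comp_smul, hf.1 x]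
    · ext v; simp only [LinearMap.smul_comp, LinearMap.comp_smul, hf.2 r u hu]

/-- The space `Hom_a(a, Hom(V₁,V₂))` of `a`-module homomorphisms from the adjoint module to
`Hom(V₁,V₂)` (the latter an `a`-module via `ρ₁`, `ρ₂`). -/
def homAa (ρ1 : a →ₗ[ℂ] Module.End ℂ V1) (ρ2 : a →ₗ[ℂ] Module.End ℂ V2) :
    Submodule ℂ (a →ₗ[ℂ] (V1 →ₗ[ℂ] V2)) where
  carrier := {θ | ∀ x y : a, θ ⁅x, y⁆ = ρ2 x ∘ₗ θ y - θ y ∘ₗ ρ1 x}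
  add_mem' := by
    intro f g hf hg x y
    ext v
    simp only [map_add, LinearMap.add_apply, LinearMap.comp_add, LinearMap.add_comp, hf x y,
      hg x y, LinearMap.sub_apply]
    abel
  zero_mem' := by intro x y; simp
  smul_mem' := by
    intro c f hf x y
    ext v
    simp only [map_smul, LinearMap.smul_apply, LinearMap.comp_smul, LinearMap.smul_comp,
      hf x y, LinearMap.sub_apply, smul_sub]

/-- The linear map `ψ ↦ η̃_ψ = (x ↦ η₂(x) ∘ ψ - ψ ∘ η₁(x))`. -/
def etaTildeMap (η1 : a →ₗ[ℂ] Module.End ℂ V1) (η2 : a →ₗ[ℂ] Module.End ℂ V2) :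
    (V1 →ₗ[ℂ] V2) →ₗ[ℂ] (a →ₗ[ℂ] (V1 →ₗ[ℂ] V2)) where
  toFun ψ :=
    { toFun := fun x => η2 x ∘ₗ ψ - ψ ∘ₗ η1 x
      map_add' := by
        intro x y
        simp only [map_add, LinearMap.add_comp, LinearMap.comp_add]
        abel
      map_smul' := by
        intro c x
        simp only [map_smul, LinearMap.smul_comp, LinearMap.comp_smul, RingHom.id_apply,
          smul_sub] }
  map_add' := by
    intro f g
    ext x v
    simp only [LinearMap.coe_mk, AddHom.coe_mk, LinearMap.add_apply, LinearMap.comp_add,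
      LinearMap.add_comp, LinearMap.sub_apply]
    abel
  map_smul' := by
    intro c f
    ext x v
    simp only [LinearMap.coe_mk, AddHom.coe_mk, LinearMap.smul_apply, LinearMap.comp_smul,
      LinearMap.smul_comp, RingHom.id_apply, LinearMap.sub_apply, smul_sub]

end

/-- A linear map that intertwines `η₁` and `η₂` intertwines their extensions to the tensor
algebra. -/
theorem comp_lift_eq_lift_comp {R M V W : Type*} [CommSemiring R] [AddCommMonoid M] [Module R M]
    [AddCommMonoid V] [Module R V] [AddCommMonoid W] [Module R W]
    {η1 : M →ₗ[R] Module.End R V} {η2 : M →ₗ[R] Module.End R W} {ψ : V →ₗ[R] W}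
    (h : ∀ x, ψ ∘ₗ η1 x = η2 x ∘ₗ ψ) (u : TensorAlgebra R M) :
    ψ ∘ₗ (TensorAlgebra.lift R η1 u : Module.End R V)
      = (TensorAlgebra.lift R η2 u : Module.End R W) ∘ₗ ψ := by
  induction u using TensorAlgebra.induction with
  | algebraMap r => ext v; simp [Module.algebraMap_end_apply]
  | ι x => simpa using h x
  | mul u v hu hv =>
    rw [map_mul, map_mul, Module.End.mul_eq_comp, Module.End.mul_eq_comp,
      ← LinearMap.comp_assoc, hu, LinearMap.comp_assoc, hv, LinearMap.comp_assoc]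
  | add u v hu hv => rw [map_add, map_add, LinearMap.comp_add, LinearMap.add_comp, hu, hv]

/-- An `a`-module homomorphism `ψ` is a homomorphism of `a[t]`-modules iff `η̃_ψ = 0`. -/
theorem mem_homAt_iff_etaTildeMap_eq_zero {a : Type*} [LieRing a] [LieAlgebra ℂ a]
    {V1 V2 : Type*} [AddCommGroup V1] [Module ℂ V1] [AddCommGroup V2] [Module ℂ V2]
    {ρ1 η1 : a →ₗ[ℂ] Module.End ℂ V1} {ρ2 η2 : a →ₗ[ℂ] Module.End ℂ V2} {ψ : V1 →ₗ[ℂ] V2}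
    (hψ : ψ ∈ homA a V1 V2 ρ1 ρ2) :
    ψ ∈ homAt a V1 V2 ρ1 η1 ρ2 η2 ↔ etaTildeMap a V1 V2 η1 η2 ψ = 0 := by
  constructor
  · intro h
    ext1 x
    have hx := h.2 1 (TensorAlgebra.ι ℂ x) ⟨x, rfl⟩
    rw [TensorAlgebra.lift_ι_apply, TensorAlgebra.lift_ι_apply] at hx
    exact sub_eq_zero.2 hx.symm
  · intro h
    exact ⟨hψ, fun _ u _ => comp_lift_eq_lift_comp
      (fun x => (sub_eq_zero.1 (LinearMap.congr_fun h x)).symm) u⟩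

/-- If `η₁` and `η₂` satisfy (C2), then `η̃_ψ` is a homomorphism of `a`-modules whenever `ψ` is. -/
theorem etaTildeMap_mem_homAa {a : Type*} [LieRing a] [LieAlgebra ℂ a]
    {V1 V2 : Type*} [AddCommGroup V1] [Module ℂ V1] [AddCommGroup V2] [Module ℂ V2]
    {ρ1 η1 : a →ₗ[ℂ] Module.End ℂ V1} {ρ2 η2 : a →ₗ[ℂ] Module.End ℂ V2}
    (h1 : ∀ x y : a, η1 ⁅x, y⁆ = ⁅ρ1 x, η1 y⁆) (h2 : ∀ x y : a, η2 ⁅x, y⁆ = ⁅ρ2 x, η2 y⁆)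
    {ψ : V1 →ₗ[ℂ] V2} (hψ : ψ ∈ homA a V1 V2 ρ1 ρ2) :
    etaTildeMap a V1 V2 η1 η2 ψ ∈ homAa a V1 V2 ρ1 ρ2 := by
  intro x y
  have hv (v : V1) : ψ (ρ1 x v) = ρ2 x (ψ v) := LinearMap.congr_fun (hψ x) v
  ext v
  simp only [etaTildeMap, LinearMap.coe_mk, AddHom.coe_mk, h1, h2, LinearMap.sub_apply,
    LinearMap.comp_apply, Ring.lie_def, Module.End.mul_apply, map_sub, hv]
  abel

/-- First isomorphism theorem for the restriction of a linear map to a submodule. -/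
theorem exists_quotient_equiv_map {R M N : Type*} [Ring R] [AddCommGroup M] [Module R M]
    [AddCommGroup N] [Module R N] (g : M →ₗ[R] N) (p : Submodule R M) (q : Submodule R p)
    (hq : ∀ x : p, x ∈ q ↔ g x = 0) :
    ∃ e : (p ⧸ q) ≃ₗ[R] p.map g, ∀ x : p, (e (Submodule.Quotient.mk x) : N) = g x := by
  obtain rfl : q = LinearMap.ker (g.submoduleMap p) := by
    ext x
    rw [hq, LinearMap.mem_ker, Subtype.ext_iff]
    rfl
  exact ⟨(g.submoduleMap p).quotKerEquivOfSurjective (g.submoduleMap_surjective p), fun _ => rfl⟩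

/-- For `(ρ₁,η₁) ∈ ℋ(V₁)`, `(ρ₂,η₂) ∈ ℋ(V₂)`, the set
`𝓔₀ = {η̃_ψ : ψ ∈ Hom_a(V₁,V₂)}`, where `η̃_ψ(x) = η₂(x)∘ψ - ψ∘η₁(x)`, is a linear subspace of
`Hom_a(a, Hom(V₁,V₂))`, and `ψ ↦ η̃_ψ` induces an isomorphism of vector spaces
`𝓔₀ ≅ Hom_a(V₁,V₂) / Hom_{a[t]}(V₁(ρ₁,η₁), V₂(ρ₂,η₂))`. -/
theorem statement11 (a : Type*) [LieRing a] [LieAlgebra ℂ a]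
    (h𝔞 : Submodule.span ℂ {z : a | ∃ x y : a, z = ⁅x, y⁆} = ⊤)
    (τ : TensorAlgebra ℂ a →ₗ[ℂ] a) (hτ : IsTau a τ)
    (V1 V2 : Type*) [AddCommGroup V1] [Module ℂ V1] [AddCommGroup V2] [Module ℂ V2]
    (ρ1 η1 : a →ₗ[ℂ] Module.End ℂ V1) (ρ2 η2 : a →ₗ[ℂ] Module.End ℂ V2)
    (h1 : MemH a τ ρ1 η1) (h2 : MemH a τ ρ2 η2) :
    Submodule.map (etaTildeMap a V1 V2 η1 η2) (homA a V1 V2 ρ1 ρ2) ≤ homAa a V1 V2 ρ1 ρ2 ∧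
    ∃ e : (↥(homA a V1 V2 ρ1 ρ2) ⧸
        (Submodule.comap (homA a V1 V2 ρ1 ρ2).subtype (homAt a V1 V2 ρ1 η1 ρ2 η2))) ≃ₗ[ℂ]
        ↥(Submodule.map (etaTildeMap a V1 V2 η1 η2) (homA a V1 V2 ρ1 ρ2)),
      ∀ ψ : ↥(homA a V1 V2 ρ1 ρ2),
        (e (Submodule.Quotient.mk ψ) : a →ₗ[ℂ] (V1 →ₗ[ℂ] V2))
          = etaTildeMap a V1 V2 η1 η2 ψ := by
  refine ⟨Submodule.map_le_iff_le_comap.2 fun ψ hψ => etaTildeMap_mem_homAa h1.2.1 h2.2.1 hψ, ?_⟩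
  exact exists_quotient_equiv_map _ _ _ fun ψ => mem_homAt_iff_etaTildeMap_eq_zero ψ.2
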